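/- (2D Hardy inequality with a time-shifted weight) Let t ≥ 0, M_0 > 0, and let f be a smooth function of x ∈ ℝ² supported in {|x| ≤ t + M_0}. Then ‖f/⟨t−|x|⟩‖_{L²(ℝ²)} ≤ C ‖∇_x f‖_{L²(ℝ²)}, where ⟨s⟩ = √(1+s²) and the constant C depends only on M_0 (not on t). -/

import Mathlib

noncomputable section
open MeasureTheory

abbrev E2 := EuclideanSpace ℝ (Fin 2)

/-- The divergence of the field `x ↦ u x • x` in the plane has integral zero
when `u` is `C¹` with compact support. -/
theorem integral_two_mul_add_fderiv_apply_self {u : E2 → ℝ} (hu : ContDiff ℝ 1 u)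
    (hc : HasCompactSupport u) :
    Integrable (fun x => 2 * u x + fderiv ℝ u x x) ∧
      ∫ x, (2 * u x + fderiv ℝ u x x) = 0 := by
  have hcf : Continuous (fderiv ℝ u) := hu.continuous_fderiv one_ne_zero
  have hiu : Integrable u := hu.continuous.integrable_of_hasCompactSupport hc
  have hpart : ∀ i : Fin 2,
      Integrable (fun x : E2 => fderiv ℝ u x (EuclideanSpace.single i 1) * x i) ∧
      ∫ x : E2, fderiv ℝ u x (EuclideanSpace.single i 1) * x i = -∫ x, u x := by
    intro i
    have hint : Integrable (fun x : E2 => fderiv ℝ u x (EuclideanSpace.single i 1) * x i) := by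
      apply Continuous.integrable_of_hasCompactSupport
      · fun_prop
      · exact (hc.fderiv_apply ℝ (EuclideanSpace.single i 1)).mul_right
    have hint' : Integrable (fun x : E2 => u x * x i) := by
      apply Continuous.integrable_of_hasCompactSupport
      · have := hu.continuous
        fun_prop
      · exact hc.mul_right
    refine ⟨hint, ?_⟩
    have key := integral_bilinear_hasLineDerivAt_right_eq_neg_left_of_integrable
      (μ := (volume : Measure E2)) (B := ContinuousLinearMap.mul ℝ ℝ)
      (f := u) (f' := fun x => fderiv ℝ u x (EuclideanSpace.single i 1))
      (g := fun x : E2 => x i) (g' := fun _ => 1) (v := EuclideanSpace.single i 1)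
      hint (by simpa using hiu) hint'
      (fun x _ => ((hu.differentiable one_ne_zero) x).hasFDerivAt.hasLineDerivAt _)
      (fun x _ => by
        simpa using
          (EuclideanSpace.proj (𝕜 := ℝ) i : E2 →L[ℝ] ℝ).hasFDerivAt.hasLineDerivAt
            (x := x) (EuclideanSpace.single i 1))
    simp only [ContinuousLinearMap.mul_apply', mul_one] at key
    linarith
  have hdecomp : ∀ x : E2, fderiv ℝ u x x =
      fderiv ℝ u x (EuclideanSpace.single 0 1) * x 0 +
      fderiv ℝ u x (EuclideanSpace.single 1 1) * x 1 := by
    intro x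
    have hx : x = x 0 • EuclideanSpace.single 0 1 + x 1 • EuclideanSpace.single 1 1 := by
      ext j
      fin_cases j <;> simp
    conv_lhs => rw [show fderiv ℝ u x x = fderiv ℝ u x
      (x 0 • EuclideanSpace.single 0 1 + x 1 • EuclideanSpace.single 1 1) from congrArg _ hx]
    simp only [map_add, map_smul, smul_eq_mul]
    ring
  simp only [hdecomp]
  have hsum : Integrable fun x : E2 => fderiv ℝ u x (EuclideanSpace.single 0 1) * x 0 +
      fderiv ℝ u x (EuclideanSpace.single 1 1) * x 1 := (hpart 0).1.add (hpart 1).1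
  refine ⟨(hiu.const_mul 2).add hsum, ?_⟩
  rw [integral_add (hiu.const_mul 2) hsum, integral_add (hpart 0).1 (hpart 1).1,
    (hpart 0).2, (hpart 1).2, integral_const_mul]
  ring

/-- The algebraic core of the pointwise estimate: `a` is the value of the function, `d` its
radial derivative times the radius `r`, and `D` the norm of its gradient. -/
theorem sq_div_le_sq_add_divergence {a d D r t M : ℝ} (ht : 0 ≤ t) (hM : 0 < M) (hr : 0 ≤ r)
    (hrt : r < t + M + 1) (hd : |d| ≤ D * r) :
    a ^ 2 / (1 + (t - r) ^ 2) ≤ 8 * (1 + M) ^ 2 *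
      (D ^ 2 + 2 * (t + M + 1) ^ 2 * (a / ((t + M + 1) ^ 2 - r ^ 2)) ^ 2 +
        2 * (a / ((t + M + 1) ^ 2 - r ^ 2)) * d) := by
  set R := t + M + 1 with hR
  have hq : 0 < R ^ 2 - r ^ 2 := by nlinarith
  set b := a / (R ^ 2 - r ^ 2) with hb
  have hab : a = b * (R ^ 2 - r ^ 2) := by rw [hb]; field_simp
  have hbd : -(|b| * (D * r)) ≤ b * d := by
    have h1 : |b * d| ≤ |b| * (D * r) := by
      rw [abs_mul]
      exact mul_le_mul_of_nonneg_left hd (abs_nonneg b)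
    linarith [neg_abs_le (b * d)]
  have hrest : R ^ 2 * b ^ 2 ≤ D ^ 2 + 2 * R ^ 2 * b ^ 2 + 2 * b * d := by
    have h2 : r ^ 2 * b ^ 2 ≤ R ^ 2 * b ^ 2 :=
      mul_le_mul_of_nonneg_right (by nlinarith) (sq_nonneg b)
    nlinarith [sq_nonneg (D - |b| * r), sq_abs b]
  have hw : (R - r) ^ 2 ≤ 2 * (1 + M) ^ 2 * (1 + (t - r) ^ 2) := by
    have : R - r = (t - r) + (1 + M) := by rw [hR]; ring
    rw [this]
    nlinarith [sq_nonneg ((t - r) - (1 + M)), mul_nonneg (sq_nonneg (t - r)) hM.le,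
      mul_nonneg (sq_nonneg (t - r)) (sq_nonneg M)]
  have hplus : (R + r) ^ 2 ≤ 4 * R ^ 2 := by nlinarith
  rw [div_le_iff₀ (by positivity)]
  calc a ^ 2 = b ^ 2 * ((R + r) ^ 2 * (R - r) ^ 2) := by rw [hab]; ring
    _ ≤ b ^ 2 * (4 * R ^ 2 * (2 * (1 + M) ^ 2 * (1 + (t - r) ^ 2))) := by gcongr
    _ = 8 * (1 + M) ^ 2 * (R ^ 2 * b ^ 2) * (1 + (t - r) ^ 2) := by ring
    _ ≤ _ := by gcongr

/-- 2D Hardy inequality with time-shifted weight `⟨t-|x|⟩`,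
with constant depending only on `M₀`. -/
theorem stmt3 (M0 : ℝ) (hM0 : 0 < M0) :
    ∃ C : ℝ, 0 < C ∧
      ∀ t : ℝ, 0 ≤ t →
        ∀ f : E2 → ℝ, ContDiff ℝ (⊤ : ℕ∞) f →
          (∀ x : E2, t + M0 < ‖x‖ → f x = 0) →
          Real.sqrt (∫ x : E2, (f x) ^ 2 / (1 + (t - ‖x‖) ^ 2)) ≤
            C * Real.sqrt (∫ x : E2, ‖fderiv ℝ f x‖ ^ 2) := by
  refine ⟨Real.sqrt (8 * (1 + M0) ^ 2), by positivity, ?_⟩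
  intro t ht f hf hsupp
  set R := t + M0 + 1 with hR
  have hf1 : ContDiff ℝ 1 f := hf.of_le (by exact_mod_cast le_top)
  have hfd : Differentiable ℝ f := hf1.differentiable one_ne_zero
  have hfc : HasCompactSupport f := by
    refine HasCompactSupport.intro (isCompact_closedBall (0 : E2) (t + M0)) fun x hx => ?_
    exact hsupp x (by simpa using hx)
  have hf0 : ∀ x : E2, t + M0 < ‖x‖ → f =ᶠ[nhds x] 0 := fun x hx => by
    filter_upwards [(isOpen_lt continuous_const continuous_norm).mem_nhds hx] with y hy
    exact hsupp y hy
  set u : E2 → ℝ := fun x => f x ^ 2 / (R ^ 2 - ‖x‖ ^ 2) with hu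
  have hu0 : ∀ x : E2, t + M0 < ‖x‖ → u =ᶠ[nhds x] 0 := fun x hx => by
    filter_upwards [hf0 x hx] with y hy
    simp [hu, hy]
  have hpos : ∀ x : E2, ‖x‖ < R → 0 < R ^ 2 - ‖x‖ ^ 2 := fun x hx => by
    nlinarith [norm_nonneg x]
  have hu1 : ContDiff ℝ 1 u := by
    rw [contDiff_iff_contDiffAt]
    intro x
    rcases lt_or_ge ‖x‖ R with hx | hx
    · exact (hf1.contDiffAt.pow 2).div
        (contDiffAt_const.sub (contDiff_norm_sq ℝ).contDiffAt) (hpos x hx).ne'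
    · exact contDiffAt_const.congr_of_eventuallyEq (hu0 x (by linarith))
  have huc : HasCompactSupport u := by
    refine HasCompactSupport.intro (isCompact_closedBall (0 : E2) (t + M0)) fun x hx => ?_
    exact (hu0 x (by simpa using hx)).self_of_nhds
  obtain ⟨hdivint, hdiv⟩ := integral_two_mul_add_fderiv_apply_self hu1 huc
  have hgrad : Integrable (fun x => ‖fderiv ℝ f x‖ ^ 2) := by
    have hcont : Continuous (fderiv ℝ f) := hf1.continuous_fderiv one_ne_zero
    apply Continuous.integrable_of_hasCompactSupport
    · fun_prop
    · exact (hfc.fderiv ℝ).comp_left (g := fun L => ‖L‖ ^ 2) (by simp)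
  have hpoint : ∀ x : E2, f x ^ 2 / (1 + (t - ‖x‖) ^ 2) ≤
      8 * (1 + M0) ^ 2 * (‖fderiv ℝ f x‖ ^ 2 + (2 * u x + fderiv ℝ u x x)) := by
    intro x
    rcases lt_or_ge ‖x‖ R with hx | hx
    · have hq := hpos x hx
      have hux : fderiv ℝ u x x =
          2 * f x * fderiv ℝ f x x / (R ^ 2 - ‖x‖ ^ 2) +
            2 * ‖x‖ ^ 2 * f x ^ 2 / (R ^ 2 - ‖x‖ ^ 2) ^ 2 := by
        have hd : HasFDerivAt (fun y : E2 => R ^ 2 - ‖y‖ ^ 2) (-(2 • innerSL ℝ x)) x :=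
          (hasStrictFDerivAt_norm_sq x).hasFDerivAt.const_sub _
        have hfun : u = (fun y => f y ^ 2) * ((·⁻¹) ∘ fun y => R ^ 2 - ‖y‖ ^ 2) := by
          ext y
          simp [hu, div_eq_mul_inv]
        rw [hfun, (((hfd x).hasFDerivAt.pow 2).mul
          ((hasDerivAt_inv hq.ne').comp_hasFDerivAt x hd)).fderiv]
        simp
        field_simp
        ring
      have hle : |fderiv ℝ f x x| ≤ ‖fderiv ℝ f x‖ * ‖x‖ := (fderiv ℝ f x).le_opNorm x
      refine (sq_div_le_sq_add_divergence (a := f x) ht hM0 (norm_nonneg x) hx hle).trans_eq ?_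
      rw [hux, ← hR]
      simp only [hu]
      field_simp
      ring
    · have hx' : t + M0 < ‖x‖ := by linarith
      rw [(hu0 x hx').fderiv_eq, (hf0 x hx').fderiv_eq, (hu0 x hx').self_of_nhds, hsupp x hx']
      simp
  rw [← Real.sqrt_mul (by positivity)]
  apply Real.sqrt_le_sqrt
  calc ∫ x : E2, f x ^ 2 / (1 + (t - ‖x‖) ^ 2)
      ≤ ∫ x : E2, 8 * (1 + M0) ^ 2 *
          (‖fderiv ℝ f x‖ ^ 2 + (2 * u x + fderiv ℝ u x x)) :=
        integral_mono_of_nonneg (.of_forall fun x => by positivity)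
          ((hgrad.add hdivint).const_mul _) (.of_forall hpoint)
    _ = 8 * (1 + M0) ^ 2 * ∫ x : E2, ‖fderiv ℝ f x‖ ^ 2 := by
        rw [integral_const_mul, integral_add hgrad hdivint, hdiv, add_zero]
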